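/- Let Ĝ^d be a swap-maximal loopy graph whose largest clique K^0 contained in V^0 has exactly d vertices, with d ≥ 3. Then every vertex u ∈ K^0 is adjacent to every vertex of V^1 (i.e., V^1 ⊆ N(u) for all u ∈ K^0). -/

import Mathlib

open scoped Classical

/-- A loopy graph: at most one edge between any two distinct vertices and at most one
self-loop at each vertex, encoded as a symmetric adjacency relation. -/
structure LoopyGraph (V : Type) where
  Adj : V → V → Prop
  symm : ∀ u v : V, Adj u v → Adj v u

namespace LoopyGraph

variable {V : Type}

/-- The neighbors of `u` (vertices other than `u` adjacent to `u`). -/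
def nbr (G : LoopyGraph V) (u : V) : Set V := {v | v ≠ u ∧ G.Adj u v}

/-- Degree of a vertex: each self-loop contributes `2`. -/
noncomputable def deg (G : LoopyGraph V) (u : V) : ℕ :=
  (G.nbr u).ncard + (if G.Adj u u then 2 else 0)

/-- `G₂` is obtained from `G₁` by a single valid double edge swap
`(u,v),(x,y) ⤳ (u,x),(v,y)`: the two removed edges are distinct edges of `G₁`, the two
added edges are distinct and not already present (no multiedge and no doubled
self-loop is created). -/
def DoubleEdgeSwap (G₁ G₂ : LoopyGraph V) : Prop :=
  ∃ u v x y : V,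
    G₁.Adj u v ∧ G₁.Adj x y ∧
    s(u, v) ≠ s(x, y) ∧
    ¬ G₁.Adj u x ∧ ¬ G₁.Adj v y ∧ s(u, x) ≠ s(v, y) ∧
    ∀ a b : V, G₂.Adj a b ↔
      ((G₁.Adj a b ∧ s(a, b) ≠ s(u, v) ∧ s(a, b) ≠ s(x, y)) ∨
        s(a, b) = s(u, x) ∨ s(a, b) = s(v, y))

/-- `G₂` is reachable from `G₁` by a finite sequence of valid double edge swaps. -/
def Reach (G₁ G₂ : LoopyGraph V) : Prop :=
  Relation.ReflTransGen DoubleEdgeSwap G₁ G₂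

/-- Vertices at (shortest-path) distance at most `k` from the set of loop-free vertices. -/
def within (G : LoopyGraph V) : ℕ → Set V
  | 0 => {v | ¬ G.Adj v v}
  | (k + 1) => within G k ∪ {v | ∃ u ∈ within G k, G.Adj v u}

/-- `Vset G 0 = V^0` is the set of vertices with no self-loop; for `k ≥ 1`,
`Vset G k = V^k` is the set of vertices (necessarily carrying a self-loop) whose
shortest-path distance to `V^0` is exactly `k`. -/
def Vset (G : LoopyGraph V) : ℕ → Set V
  | 0 => {v | ¬ G.Adj v v}
  | (k + 1) => within G (k + 1) \ within G k

/-- `V^∞`: vertices (with a self-loop) having no path to `V^0`. -/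
def Vinf (G : LoopyGraph V) : Set V := {v | ∀ k : ℕ, v ∉ within G k}

/-- A set of vertices is a clique when all pairs of distinct members are adjacent. -/
def IsClique (G : LoopyGraph V) (s : Set V) : Prop :=
  ∀ x ∈ s, ∀ y ∈ s, x ≠ y → G.Adj x y

/-- The set of vertices carrying a self-loop. -/
def selfLoops (G : LoopyGraph V) : Set V := {v | G.Adj v v}

/-- The edges of `G` with both endpoints in `V^0`. -/
def V0edges (G : LoopyGraph V) : Set (Sym2 V) :=
  {e | ∃ u v : V, e = s(u, v) ∧ G.Adj u v ∧ u ∈ Vset G 0 ∧ v ∈ Vset G 0}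

/-- `Ĝ` is swap-maximal: among all loopy graphs reachable from it by double edge swaps it
has the maximum number of self-loops, and subject to that the maximum number of edges with
both endpoints in `V^0`. -/
def SwapMaximal (G : LoopyGraph V) : Prop :=
  ∀ H : LoopyGraph V, Reach G H →
    (selfLoops H).ncard ≤ (selfLoops G).ncard ∧
      ((selfLoops H).ncard = (selfLoops G).ncard →
        (V0edges H).ncard ≤ (V0edges G).ncard)

/-- `K` is a largest clique contained in `V^0`, and it has exactly `d` vertices. -/
def LargestV0Clique (G : LoopyGraph V) (K : Set V) (d : ℕ) : Prop :=
  K ⊆ Vset G 0 ∧ IsClique G K ∧ K.ncard = d ∧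
    ∀ K' : Set V, K' ⊆ Vset G 0 → IsClique G K' → K'.ncard ≤ d

/-- Class `Q1`. -/
def Q1 (G : LoopyGraph V) : Prop :=
  ∃ K : Set V, K ⊆ Vset G 0 ∧ 4 ≤ K.ncard ∧ IsClique G K ∧
    (∀ u ∈ Vset G 0, (∀ w ∈ Vset G 0, ¬ G.Adj u w) ∨ u ∈ K) ∧
    IsClique G (Vset G 1 ∪ K) ∧
    Vset G 2 = ∅ ∧ Vinf G = ∅

/-- Class `Q2`. -/
def Q2 (G : LoopyGraph V) : Prop :=
  3 ≤ {u | u ∈ Vset G 0 ∧ (nbr G u ∩ Vset G 0).ncard = 2}.ncard ∧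
  (∀ u ∈ Vset G 0,
      (∀ w ∈ Vset G 0, ¬ G.Adj u w) ∨
        ((nbr G u ∩ Vset G 0).ncard = 2 ∧ ∀ w ∈ Vset G 1, G.Adj u w)) ∧
  IsClique G (Vset G 1) ∧
  (∀ u ∈ Vset G 2, nbr G u = Vset G 1) ∧
  Vset G 3 = ∅ ∧
  (Vinf G = ∅ ∨ (Vset G 1 = ∅ ∧ ∀ u ∈ Vinf G, deg G u = 2))

/-- The graph of loopy graphs `𝒢({k_i})` is connected: any two loopy graphs with degree
sequence `k` are linked by a finite sequence of valid double edge swaps. -/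
def GConnected (k : V → ℕ) : Prop :=
  ∀ G₁ G₂ : LoopyGraph V, (∀ v, deg G₁ v = k v) → (∀ v, deg G₂ v = k v) →
    Reach G₁ G₂

/-- `G₂` is obtained from `G₁` by a single valid triangle-loop swap: either a triangle on
three distinct vertices is replaced by three self-loops, or conversely. -/
def TriangleLoopSwap (G₁ G₂ : LoopyGraph V) : Prop :=
  ∃ u v w : V, u ≠ v ∧ v ≠ w ∧ u ≠ w ∧
    ((G₁.Adj u v ∧ G₁.Adj v w ∧ G₁.Adj w u ∧
        ¬ G₁.Adj u u ∧ ¬ G₁.Adj v v ∧ ¬ G₁.Adj w w ∧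
        ∀ a b : V, G₂.Adj a b ↔
          ((G₁.Adj a b ∧ s(a, b) ≠ s(u, v) ∧ s(a, b) ≠ s(v, w) ∧ s(a, b) ≠ s(w, u)) ∨
            s(a, b) = s(u, u) ∨ s(a, b) = s(v, v) ∨ s(a, b) = s(w, w))) ∨
      (G₁.Adj u u ∧ G₁.Adj v v ∧ G₁.Adj w w ∧
        ¬ G₁.Adj u v ∧ ¬ G₁.Adj v w ∧ ¬ G₁.Adj w u ∧
        ∀ a b : V, G₂.Adj a b ↔
          ((G₁.Adj a b ∧ s(a, b) ≠ s(u, u) ∧ s(a, b) ≠ s(v, v) ∧ s(a, b) ≠ s(w, w)) ∨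
            s(a, b) = s(u, v) ∨ s(a, b) = s(v, w) ∨ s(a, b) = s(w, u))))

/-- Reachability in the augmented graph of loopy graphs `𝒢_△`: a finite sequence of moves,
each a valid double edge swap or a valid triangle-loop swap. -/
def ReachTri (G₁ G₂ : LoopyGraph V) : Prop :=
  Relation.ReflTransGen
    (fun H₁ H₂ => DoubleEdgeSwap H₁ H₂ ∨ TriangleLoopSwap H₁ H₂) G₁ G₂

/-- `S` is a set of highest-degree vertices for the degree sequence `k`. -/
def TopSet (k : V → ℕ) (S : Set V) : Prop :=
  ∀ u ∈ S, ∀ v : V, v ∉ S → k v ≤ k u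

/-- A loopy graph is simple when it has no self-loops. -/
def IsSimple (G : LoopyGraph V) : Prop := ∀ v : V, ¬ G.Adj v v

/-- `k` is the degree sequence of some simple graph. -/
def SimpleGraphical (k : V → ℕ) : Prop :=
  ∃ G : LoopyGraph V, IsSimple G ∧ ∀ v, deg G v = k v

/-- `k` is `m`-simple-graphical: subtracting `2` from each of the `m` largest entries
yields a simple-graphical sequence. -/
def MSimpleGraphical (k : V → ℕ) (m : ℕ) : Prop :=
  ∃ S : Set V, S.ncard = m ∧ TopSet k S ∧ (∀ v ∈ S, 2 ≤ k v) ∧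
    SimpleGraphical (fun v : V => if v ∈ S then k v - 2 else k v)

/-- `m` is `m*`, the maximum `m` for which the sequence is `m`-simple-graphical. -/
def IsMStar (k : V → ℕ) (m : ℕ) : Prop :=
  MSimpleGraphical k m ∧ ∀ m' : ℕ, MSimpleGraphical k m' → m' ≤ m

/-- `G` is `m`-loopy: it has self-loops exactly at `m` highest-degree vertices. -/
def MLoopy (G : LoopyGraph V) (m : ℕ) : Prop :=
  (selfLoops G).ncard = m ∧ TopSet (deg G) (selfLoops G)

end LoopyGraph

namespace LoopyGraph

variable {V : Type}

/-- The graph obtained from `G` by exchanging the edges `(u,v),(x,y)` for `(u,x),(v,y)`. -/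
def swap (G : LoopyGraph V) (u v x y : V) : LoopyGraph V where
  Adj a b := (G.Adj a b ∧ s(a, b) ≠ s(u, v) ∧ s(a, b) ≠ s(x, y)) ∨
    s(a, b) = s(u, x) ∨ s(a, b) = s(v, y)
  symm a b h := by
    rw [Sym2.eq_swap (a := b) (b := a)]
    exact h.imp_left fun h => ⟨G.symm _ _ h.1, h.2⟩

theorem swap_adj (G : LoopyGraph V) (u v x y a b : V) :
    (G.swap u v x y).Adj a b ↔
      (G.Adj a b ∧ s(a, b) ≠ s(u, v) ∧ s(a, b) ≠ s(x, y)) ∨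
        s(a, b) = s(u, x) ∨ s(a, b) = s(v, y) :=
  Iff.rfl

theorem doubleEdgeSwap_swap {G : LoopyGraph V} {u v x y : V} (huv : G.Adj u v)
    (hxy : G.Adj x y) (hne : s(u, v) ≠ s(x, y)) (hux : ¬ G.Adj u x) (hvy : ¬ G.Adj v y)
    (hne' : s(u, x) ≠ s(v, y)) : DoubleEdgeSwap G (G.swap u v x y) :=
  ⟨u, v, x, y, huv, hxy, hne, hux, hvy, hne', fun _ _ => Iff.rfl⟩

/-- In a graph reachable from a swap-maximal graph and with as many self-loops, the neighbors
of a loop-free vertex are pairwise adjacent: otherwise a swap would create a self-loop. -/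
theorem SwapMaximal.adj_of_adj_of_adj [Finite V] {G H : LoopyGraph V} (hmax : G.SwapMaximal)
    (hreach : Reach G H) (hloops : selfLoops H = selfLoops G) {a b c : V}
    (ha : ¬ H.Adj a a) (hab : H.Adj a b) (hac : H.Adj a c) (hbc : b ≠ c) : H.Adj b c := by
  by_contra hn
  have hba : b ≠ a := fun h => ha (h ▸ hab)
  have hca : c ≠ a := fun h => ha (h ▸ hac)
  have hswap : DoubleEdgeSwap H (H.swap a b a c) :=
    doubleEdgeSwap_swap hab hac (by grind) ha hn (by grind)
  have hle := (hmax _ (hreach.tail hswap)).1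
  have hsub : selfLoops G ⊂ selfLoops (H.swap a b a c) := by
    rw [← hloops, Set.ssubset_iff_of_subset]
    · exact ⟨a, Or.inr (Or.inl rfl), ha⟩
    · intro t ht
      exact Or.inl ⟨ht, by grind, by grind⟩
  exact absurd (Set.ncard_lt_ncard hsub) (not_lt.mpr hle)

end LoopyGraph

/-- In a swap-maximal loopy graph `Ĝ^d` with `d ≥ 3`, every vertex of the
largest clique `K^0 ⊆ V^0` is adjacent to every vertex of `V^1`. -/
theorem swap_maximal_K0_adj_V1 {V : Type} [Fintype V] (G : LoopyGraph V)
    (hmax : G.SwapMaximal) (K : Set V) (d : ℕ) (hd : 3 ≤ d)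
    (hK : LoopyGraph.LargestV0Clique G K d) :
    ∀ u ∈ K, LoopyGraph.Vset G 1 ⊆ G.nbr u := by
  open LoopyGraph in
  intro u hu w hw
  obtain ⟨hK0, hKc, hKcard, -⟩ := hK
  have hww : G.Adj w w := not_not.mp hw.2
  obtain ⟨z, hz, hwz⟩ : ∃ z ∈ within G 0, G.Adj w z := hw.1.resolve_left hw.2
  have hzz : ¬ G.Adj z z := hz
  have hloopfree : ∀ k ∈ K, ¬ G.Adj k k := fun k hk => hK0 hk
  have hne : ∀ k ∈ K, k ≠ w := fun k hk h => hloopfree k hk (h ▸ hww)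
  have hclique {a b c : V} := hmax.adj_of_adj_of_adj .refl rfl (a := a) (b := b) (c := c)
  refine ⟨(hne u hu).symm, ?_⟩
  by_contra huw
  have hKw : ∀ k ∈ K, ¬ G.Adj k w := by
    intro k hk hkw
    have hku : k ≠ u := fun h => huw (h ▸ hkw)
    exact huw (hclique (hloopfree k hk) (hKc k hk u hu hku) hkw (hne u hu))
  have hKz : ∀ k ∈ K, ¬ G.Adj k z := fun k hk hkz =>
    hKw k hk (hclique hzz (G.symm _ _ hkz) (G.symm _ _ hwz) (hne k hk))
  have hzK : ∀ k ∈ K, k ≠ z := fun k hk h => hKw k hk (h ▸ G.symm _ _ hwz)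
  obtain ⟨p, q, hp, hq, hpq⟩ : ∃ p q, p ∈ K \ {u} ∧ q ∈ K \ {u} ∧ p ≠ q := by
    have hcard := Set.ncard_sdiff_singleton_add_one hu
    exact (Set.one_lt_ncard_iff).mp (by omega)
  have hup : u ≠ p := fun h => hp.2 h.symm
  have huq : u ≠ q := fun h => hq.2 h.symm
  have hzu := hzK u hu
  have hzp := hzK p hp.1
  have hzq := hzK q hq.1
  have hwu := hne u hu
  have hwp := hne p hp.1
  have hzw : z ≠ w := fun h => hzz (h ▸ hww)
  -- Moving the edges `u p` and `z w` keeps all self-loops but makes `u` adjacent to both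
  -- `z` and `q`, which stay non-adjacent.
  have hswap : DoubleEdgeSwap G (G.swap u p z w) :=
    doubleEdgeSwap_swap (hKc u hu p hp.1 hup) (G.symm _ _ hwz) (by grind) (hKz u hu)
      (hKw p hp.1) (by grind)
  have hloops : selfLoops (G.swap u p z w) = selfLoops G := by
    ext t
    simp only [selfLoops, Set.mem_ofPred_eq, swap_adj]
    grind
  have hzq' : (G.swap u p z w).Adj z q :=
    hmax.adj_of_adj_of_adj (.single hswap) hloops (a := u)
      (fun h => hloopfree u hu (hloops.subset h)) (Or.inr (Or.inl rfl))
      (Or.inl ⟨hKc u hu q hq.1 huq, by grind, by grind⟩) hzq.symm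
  have := hKz q hq.1
  have hqz : ¬ G.Adj z q := fun h => this (G.symm _ _ h)
  rw [swap_adj] at hzq'
  grind
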